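/- Let G be a 2-rigid graph and let y be a vertex of G of degree 3 with N_G(y) = {x₁,x₂,x₃}, such that each of the three edges incident with y is an ℛ₂-bridge of G. Then {x_i,x_j} is not 2-linked in G−y for some 1 ≤ i < j ≤ 3. -/

import Mathlib

open scoped BigOperators

noncomputable section

namespace Rigidity

variable {V : Type*}

/-- Euclidean distance between two points of `ℝ^d` (given as coordinate functions). -/
def eDist {d : ℕ} (x y : Fin d → ℝ) : ℝ := Real.sqrt (∑ i, (x i - y i) ^ 2)

/-- Two frameworks `(G,p)` and `(G,q)` are equivalent if corresponding edge lengths agree. -/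
def Equivalent {d : ℕ} (G : SimpleGraph V) (p q : V → Fin d → ℝ) : Prop :=
  ∀ u v : V, G.Adj u v → eDist (p u) (p v) = eDist (q u) (q v)

/-- Two placements are congruent if all pairwise distances agree. -/
def Congruent {d : ℕ} (p q : V → Fin d → ℝ) : Prop :=
  ∀ u v : V, eDist (p u) (p v) = eDist (q u) (q v)

/-- A placement is generic if the multiset of its coordinates is algebraically
independent over `ℚ`. -/
def Generic {d : ℕ} (p : V → Fin d → ℝ) : Prop :=
  AlgebraicIndependent ℚ (fun vi : V × Fin d => p vi.1 vi.2)

/-- `{u,v}` is globally linked in the framework `(G,p)`. -/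
def GloballyLinkedIn {d : ℕ} (G : SimpleGraph V) (p : V → Fin d → ℝ) (u v : V) : Prop :=
  ∀ q : V → Fin d → ℝ, Equivalent G p q → eDist (q u) (q v) = eDist (p u) (p v)

/-- `{u,v}` is globally `d`-linked in `G`. -/
def GloballyLinked (d : ℕ) (G : SimpleGraph V) (u v : V) : Prop :=
  ∀ p : V → Fin d → ℝ, Generic p → GloballyLinkedIn G p u v

/-- The framework `(G,p)` is rigid. -/
def RigidFramework {d : ℕ} (G : SimpleGraph V) (p : V → Fin d → ℝ) : Prop :=
  ∃ ε > (0:ℝ), ∀ q : V → Fin d → ℝ, Equivalent G p q →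
    (∀ v, eDist (p v) (q v) < ε) → Congruent p q

/-- `G` is `d`-rigid: every generic framework of `G` in `ℝ^d` is rigid. -/
def IsRigidGraph (d : ℕ) (G : SimpleGraph V) : Prop :=
  ∀ p : V → Fin d → ℝ, Generic p → RigidFramework G p

/-- The framework `(G,p)` is globally rigid. -/
def GloballyRigidFramework {d : ℕ} (G : SimpleGraph V) (p : V → Fin d → ℝ) : Prop :=
  ∀ q : V → Fin d → ℝ, Equivalent G p q → Congruent p q

/-- The row of the rigidity matrix corresponding to the (ordered) edge `(u,v)`. -/
def edgeVec [DecidableEq V] {d : ℕ} (p : V → Fin d → ℝ) (u v : V) : V × Fin d → ℝ :=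
  fun wi => if wi.1 = u then p u wi.2 - p v wi.2
            else if wi.1 = v then p v wi.2 - p u wi.2 else 0

/-- The rank of the set of rows of the rigidity matrix of `(·,p)` indexed by `F`. -/
def rankAt [DecidableEq V] (d : ℕ) (p : V → Fin d → ℝ) (F : Set (Sym2 V)) : ℕ :=
  Module.finrank ℝ (Submodule.span ℝ
    {x : V × Fin d → ℝ | ∃ u v : V, s(u, v) ∈ F ∧ x = edgeVec p u v})

/-- `r_d(F)`: the rank of the set of rows indexed by `F` of the rigidity matrix of a
generic framework, equivalently the maximum of this rank over all placements. -/
def rd [DecidableEq V] (d : ℕ) (F : Set (Sym2 V)) : ℕ :=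
  sSup {n : ℕ | ∃ p : V → Fin d → ℝ, n = rankAt d p F}

/-- An edge set is `ℛ_d`-independent if its rank equals its cardinality. -/
def RdIndep [DecidableEq V] (d : ℕ) (F : Set (Sym2 V)) : Prop := rd d F = F.ncard

/-- An `ℛ_d`-circuit: not independent, but every proper subset is independent. -/
def RdCircuit [DecidableEq V] (d : ℕ) (C : Set (Sym2 V)) : Prop :=
  ¬ RdIndep d C ∧ ∀ C' : Set (Sym2 V), C' ⊂ C → RdIndep d C'

/-- An `ℛ_d`-circuit of the graph `G`. -/
def RdCircuitOf [DecidableEq V] (d : ℕ) (G : SimpleGraph V) (C : Set (Sym2 V)) : Prop :=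
  C ⊆ G.edgeSet ∧ RdCircuit d C

/-- `F` is (the edge set of) an `ℛ_d`-component of `G`: an equivalence class of the
relation "`e = f` or some `ℛ_d`-circuit of `G` contains both `e` and `f`". -/
def IsRdComponent [DecidableEq V] (d : ℕ) (G : SimpleGraph V) (F : Set (Sym2 V)) : Prop :=
  ∃ e ∈ G.edgeSet, F = {f | f ∈ G.edgeSet ∧
    (e = f ∨ ∃ C, RdCircuitOf d G C ∧ e ∈ C ∧ f ∈ C)}

/-- The set of vertices covered by an edge set. -/
def vertexSpan (F : Set (Sym2 V)) : Set V := {v | ∃ e ∈ F, v ∈ e}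

/-- A nonempty edge set is `ℛ_d`-connected if any two of its edges lie on a common
`ℛ_d`-circuit contained in it (or are equal). -/
def RdConnectedSet [DecidableEq V] (d : ℕ) (F : Set (Sym2 V)) : Prop :=
  F.Nonempty ∧ ∀ e ∈ F, ∀ f ∈ F, e = f ∨ ∃ C, C ⊆ F ∧ RdCircuit d C ∧ e ∈ C ∧ f ∈ C

/-- A graph (with at least one edge) is `ℛ_d`-connected. -/
def RdConnected [DecidableEq V] (d : ℕ) (H : SimpleGraph V) : Prop :=
  RdConnectedSet d H.edgeSet

/-- `e` is an `ℛ_d`-bridge of `G`: `r_d(E ∖ {e}) = r_d(E) − 1`. -/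
def IsRdBridge [DecidableEq V] (d : ℕ) (G : SimpleGraph V) (e : Sym2 V) : Prop :=
  e ∈ G.edgeSet ∧ rd d (G.edgeSet \ {e}) + 1 = rd d G.edgeSet

/-- `G + uv`. -/
def addEdge (G : SimpleGraph V) (u v : V) : SimpleGraph V :=
  G ⊔ SimpleGraph.fromEdgeSet {s(u, v)}

/-- `{u,v}` is `d`-linked in `G` if `r_d(G+uv) = r_d(G)`. -/
def IsLinked [DecidableEq V] (d : ℕ) (G : SimpleGraph V) (u v : V) : Prop :=
  rd d (addEdge G u v).edgeSet = rd d G.edgeSet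

/-- There exist `k` pairwise internally vertex-disjoint `u`–`v` paths in `H`
(i.e. `κ_H(u,v) ≥ k`). -/
def InternallyDisjointPaths (H : SimpleGraph V) (u v : V) (k : ℕ) : Prop :=
  ∃ P : Fin k → H.Walk u v, (∀ i, (P i).IsPath) ∧
    ∀ i j, i ≠ j → ∀ w, w ∈ (P i).support → w ∈ (P j).support → w = u ∨ w = v

/-- An unordered pair forming a 2-separator: two distinct vertices whose deletion
disconnects the graph. -/
def TwoSepPair (H : SimpleGraph V) (e : Sym2 V) : Prop :=
  ¬ e.IsDiag ∧ ¬ (H.induce {v | v ∉ e}).Connected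

/-- The augmented graph `Ĥ`: add an edge for every 2-separator. -/
def aug (H : SimpleGraph V) : SimpleGraph V :=
  H ⊔ SimpleGraph.fromEdgeSet {e | TwoSepPair H e}

/-- A subgraph is 3-connected: at least 4 vertices, and deleting fewer than 3
vertices leaves it connected. -/
def IsThreeConnectedSubgraph {G : SimpleGraph V} (J : G.Subgraph) : Prop :=
  4 ≤ J.verts.ncard ∧ ∀ S : Set V, S.ncard < 3 → (J.deleteVerts S).coe.Connected

/-- A 3-block of `H`: a maximal 3-connected subgraph of the augmented graph `Ĥ`. -/
def IsThreeBlock (H : SimpleGraph V) (J : (aug H).Subgraph) : Prop :=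
  IsThreeConnectedSubgraph J ∧
    ∀ J' : (aug H).Subgraph, IsThreeConnectedSubgraph J' → J ≤ J' → J = J'

/-- `h_H(e)`: the number of 3-blocks of `H` containing both vertices of `e`. -/
def numBlocksOn (H : SimpleGraph V) (e : Sym2 V) : ℕ :=
  {J : (aug H).Subgraph | IsThreeBlock H J ∧ ∀ v ∈ e, v ∈ J.verts}.ncard

open Classical in
/-- `k(H) = Σ (h_H(ab) − 1)` over all 2-separators `{a,b}` of `H`. -/
def kGraph [Fintype V] [DecidableEq V] (H : SimpleGraph V) : ℕ :=
  ∑ e : Sym2 V, if TwoSepPair H e then numBlocksOn H e - 1 else 0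

/-- The graph of an `ℛ₂`-component, on its own vertex set. -/
def componentGraph [DecidableEq V] (F : Set (Sym2 V)) :
    SimpleGraph (vertexSpan F) :=
  (SimpleGraph.fromEdgeSet F).induce (vertexSpan F)

/-- `X` is the vertex set of an `ℛ_d`-block of `G`: a 3-block of a non-trivial
`ℛ_d`-component of `G`. -/
def IsRdBlockVerts [DecidableEq V] (d : ℕ) (G : SimpleGraph V) (X : Set V) : Prop :=
  ∃ F : Set (Sym2 V), IsRdComponent d G F ∧ 2 ≤ F.ncard ∧
    ∃ J : (aug (componentGraph F)).Subgraph,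
      IsThreeBlock (componentGraph F) J ∧ X = Subtype.val '' J.verts

/-- The globally linked closure of `G` in `ℝ^d`. -/
def glc (d : ℕ) (G : SimpleGraph V) : SimpleGraph V :=
  G ⊔ SimpleGraph.fromEdgeSet {e | ∃ u v : V, e = s(u, v) ∧ GloballyLinked d G u v}

/-- A globally `d`-linked cluster: the vertex set of a maximal complete subgraph of
`glc_d(G)`. -/
def IsCluster (d : ℕ) (G : SimpleGraph V) (X : Set V) : Prop :=
  (∀ a ∈ X, ∀ b ∈ X, a ≠ b → (glc d G).Adj a b) ∧
    ∀ Y : Set V, X ⊆ Y → (∀ a ∈ Y, ∀ b ∈ Y, a ≠ b → (glc d G).Adj a b) → Y = X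

/-- Equilibrium stress of a framework, encoded as a symmetric function vanishing on
non-edges. -/
def IsEqStress [Fintype V] {d : ℕ} (G : SimpleGraph V) (p : V → Fin d → ℝ)
    (ω : V → V → ℝ) : Prop :=
  (∀ u v, ω u v = ω v u) ∧ (∀ u v, ¬ G.Adj u v → ω u v = 0) ∧
    ∀ u, ∑ v, ω u v • (p u - p v) = 0

/-- `{u,v}` is `d`-stress-linked in `G`. -/
def StressLinked [Fintype V] (d : ℕ) (G : SimpleGraph V) (u v : V) : Prop :=
  ∀ p : V → Fin d → ℝ, Generic p → ∀ q : V → Fin d → ℝ,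
    (∀ ω, IsEqStress G p ω → IsEqStress G q ω) →
    ∀ ω, IsEqStress (addEdge G u v) p ω → IsEqStress (addEdge G u v) q ω

/-- Equivalence of complex frameworks. -/
def CEquivalent {d : ℕ} (G : SimpleGraph V) (p q : V → Fin d → ℂ) : Prop :=
  ∀ u v : V, G.Adj u v →
    ∑ i, (p u i - p v i) ^ 2 = ∑ i, (q u i - q v i) ^ 2

/-- Generic complex placement. -/
def CGeneric {d : ℕ} (p : V → Fin d → ℂ) : Prop :=
  AlgebraicIndependent ℚ (fun vi : V × Fin d => p vi.1 vi.2)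

/-- `{u,v}` is globally linked in `G` in `ℂ^d`. -/
def CGloballyLinked (d : ℕ) (G : SimpleGraph V) (u v : V) : Prop :=
  ∀ p : V → Fin d → ℂ, CGeneric p → ∀ q : V → Fin d → ℂ, CEquivalent G p q →
    ∑ i, (q u i - q v i) ^ 2 = ∑ i, (p u i - p v i) ^ 2

/-- A flexing of the framework `(G,q)`. -/
def IsFlexing {d : ℕ} (G : SimpleGraph V) (q : V → Fin d → ℝ)
    (φ : Set.Icc (0:ℝ) 1 → V → Fin d → ℝ) : Prop :=
  Continuous φ ∧ φ ⟨0, Set.left_mem_Icc.mpr zero_le_one⟩ = q ∧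
    (∀ t, Equivalent G q (φ t)) ∧
    ∀ t : Set.Icc (0:ℝ) 1, 0 < (t : ℝ) → ¬ Congruent q (φ t)

/-- A finite loopless multigraph on vertex type `V` with edge type `E`. -/
structure Multigraph (V : Type*) (E : Type*) where
  ends : E → Sym2 V
  loopless : ∀ e, ¬ (ends e).IsDiag

/-- The data `(B, bar)` exhibits `G` as a body-bar graph induced by `H`. -/
def IsBodyBar {V E W : Type*} (H : Multigraph V E) (G : SimpleGraph W)
    (B : V → Set W) (bar : E → W × W) : Prop :=
  (∀ w : W, ∃! v : V, w ∈ B v) ∧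
  (∀ v : V, (B v).ncard = {e : E | v ∈ H.ends e}.ncard) ∧
  (∀ e : E, ∃ w z : V, H.ends e = s(w, z) ∧ (bar e).1 ∈ B w ∧ (bar e).2 ∈ B z) ∧
  (∀ e : E, (bar e).1 ≠ (bar e).2) ∧
  (∀ e e' : E, e ≠ e' →
    ({(bar e).1, (bar e).2} ∩ {(bar e').1, (bar e').2} : Set W) = ∅) ∧
  (∀ a b : W, G.Adj a b ↔ a ≠ b ∧
    ((∃ v : V, a ∈ B v ∧ b ∈ B v) ∨ ∃ e : E, s(a, b) = s((bar e).1, (bar e).2)))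

/-- `P` is a partition of the set `X`. -/
def IsPartitionOf {V : Type*} (X : Set V) (P : Set (Set V)) : Prop :=
  (∀ p ∈ P, p.Nonempty ∧ p ⊆ X) ∧ ∀ v ∈ X, ∃! p, p ∈ P ∧ v ∈ p

/-- The subgraph `(X,F)` of the multigraph `H` is `k`-tree-connected. -/
def SubTreeConnected {V E : Type*} (k : ℕ) (H : Multigraph V E)
    (X : Set V) (F : Set E) : Prop :=
  X.Nonempty ∧ (∀ e ∈ F, ∀ v ∈ H.ends e, v ∈ X) ∧
    ∀ P : Set (Set V), IsPartitionOf X P →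
      k * (P.ncard - 1) ≤ {e | e ∈ F ∧ ¬ ∃ p ∈ P, ∀ v ∈ H.ends e, v ∈ p}.ncard

/-- `(X,F)` is a `k`-superbrick of `H`: a maximal `k`-tree-connected subgraph. -/
def IsSuperbrick {V E : Type*} (k : ℕ) (H : Multigraph V E)
    (X : Set V) (F : Set E) : Prop :=
  SubTreeConnected k H X F ∧
    ∀ X' F', SubTreeConnected k H X' F' → X ⊆ X' → F ⊆ F' → X = X' ∧ F = F'

/-- A property of placements holds Zariski-generically if it holds wherever some nonzero
polynomial in the coordinates does not vanish. -/
def ZariskiGeneric {d : ℕ} (P : (V → Fin d → ℝ) → Prop) : Prop :=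
  ∃ f : MvPolynomial (V × Fin d) ℝ, f ≠ 0 ∧
    ∀ p : V → Fin d → ℝ, MvPolynomial.eval (fun vi => p vi.1 vi.2) f ≠ 0 → P p

theorem ZariskiGeneric.and {d : ℕ} {P Q : (V → Fin d → ℝ) → Prop}
    (hP : ZariskiGeneric P) (hQ : ZariskiGeneric Q) : ZariskiGeneric fun p => P p ∧ Q p := by
  obtain ⟨f, hf, hfP⟩ := hP
  obtain ⟨g, hg, hgQ⟩ := hQ
  refine ⟨f * g, mul_ne_zero hf hg, fun p hp => ?_⟩
  rw [map_mul] at hp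
  exact ⟨hfP p (left_ne_zero_of_mul hp), hgQ p (right_ne_zero_of_mul hp)⟩

theorem ZariskiGeneric.exists_placement {d : ℕ} {P : (V → Fin d → ℝ) → Prop}
    (hP : ZariskiGeneric P) : ∃ p, P p := by
  obtain ⟨f, hf, hfP⟩ := hP
  by_contra! h
  refine hf (MvPolynomial.funext fun x => ?_)
  by_contra hx
  exact h (fun v i => x (v, i)) (hfP _ (by simpa using hx))

/-- A polynomial condition satisfied by one placement is satisfied generically. -/
theorem zariskiGeneric_of_eval_ne_zero {d : ℕ} (f : MvPolynomial (V × Fin d) ℝ)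
    (p : V → Fin d → ℝ) (hp : MvPolynomial.eval (fun vi => p vi.1 vi.2) f ≠ 0) :
    ZariskiGeneric fun q : V → Fin d → ℝ =>
      MvPolynomial.eval (fun vi => q vi.1 vi.2) f ≠ 0 :=
  ⟨f, by rintro rfl; simp at hp, fun _ h => h⟩

/-- The rows of a real matrix are linearly independent iff its Gram determinant is nonzero. -/
theorem linearIndependent_row_iff_det_mul_transpose_ne_zero {m n : Type*} [Fintype m]
    [DecidableEq m] [Fintype n] (A : Matrix m n ℝ) :
    LinearIndependent ℝ A.row ↔ (A * A.transpose).det ≠ 0 := by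
  rw [← isUnit_iff_ne_zero, ← Matrix.isUnit_iff_isUnit_det,
    ← Matrix.linearIndependent_rows_iff_isUnit,
    linearIndependent_iff_card_eq_finrank_span, linearIndependent_iff_card_eq_finrank_span,
    Set.finrank, Set.finrank, ← Matrix.rank_eq_finrank_span_row,
    ← Matrix.rank_eq_finrank_span_row, Matrix.rank_self_mul_transpose]

section RowSpan

variable [DecidableEq V] {d : ℕ}

/-- The span of the rows of the rigidity matrix indexed by `F`. -/
def rowSpan (p : V → Fin d → ℝ) (F : Set (Sym2 V)) : Submodule ℝ (V × Fin d → ℝ) :=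
  Submodule.span ℝ {x | ∃ u v : V, s(u, v) ∈ F ∧ x = edgeVec p u v}

theorem edgeVec_mem_rowSpan (p : V → Fin d → ℝ) {F : Set (Sym2 V)} {u v : V}
    (h : s(u, v) ∈ F) : edgeVec p u v ∈ rowSpan p F :=
  Submodule.subset_span ⟨u, v, h, rfl⟩

theorem rowSpan_mono (p : V → Fin d → ℝ) {F F' : Set (Sym2 V)} (h : F ⊆ F') :
    rowSpan p F ≤ rowSpan p F' :=
  Submodule.span_mono fun _ ⟨u, v, huv, hx⟩ => ⟨u, v, h huv, hx⟩

theorem edgeVec_comm (p : V → Fin d → ℝ) (u v : V) : edgeVec p u v = edgeVec p v u := by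
  funext wi
  unfold edgeVec
  split_ifs <;> simp_all

/-- The entries of `edgeVec` as polynomials in the coordinates of the placement. -/
def edgePoly (u v : V) (wi : V × Fin d) : MvPolynomial (V × Fin d) ℝ :=
  if wi.1 = u then MvPolynomial.X (u, wi.2) - MvPolynomial.X (v, wi.2)
  else if wi.1 = v then MvPolynomial.X (v, wi.2) - MvPolynomial.X (u, wi.2) else 0

theorem eval_edgePoly (p : V → Fin d → ℝ) (u v : V) (wi : V × Fin d) :
    MvPolynomial.eval (fun vi => p vi.1 vi.2) (edgePoly u v wi) = edgeVec p u v wi := by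
  unfold edgePoly edgeVec
  split_ifs <;> simp

theorem rankAt_image_map {W : Type*} [DecidableEq W] (f : W ↪ V) (p : V → Fin d → ℝ)
    (F : Set (Sym2 W)) :
    rankAt d p (Sym2.map f '' F) = rankAt d (p ∘ f) F := by
  let L : (W × Fin d → ℝ) →ₗ[ℝ] (V × Fin d → ℝ) :=
    Function.ExtendByZero.linearMap ℝ (Prod.map f id)
  have hinj : Function.Injective (Prod.map f id : W × Fin d → V × Fin d) :=
    f.injective.prodMap Function.injective_id
  have hL : Function.Injective L := fun x z h => by
    funext i
    simpa [L, hinj.extend_apply] using congrFun h (Prod.map f id i)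
  have key : ∀ u v : W, L (edgeVec (p ∘ f) u v) = edgeVec p (f u) (f v) := by
    intro u v
    funext ⟨w, k⟩
    by_cases hw : ∃ w', f w' = w
    · obtain ⟨w', rfl⟩ := hw
      have := hinj.extend_apply (edgeVec (p ∘ f) u v) 0 (w', k)
      simp only [Prod.map_apply, id] at this
      simp [L, this, edgeVec]
    · have h1 : w ≠ f u := fun h => hw ⟨u, h.symm⟩
      have h2 : w ≠ f v := fun h => hw ⟨v, h.symm⟩
      have : ¬ ∃ a, Prod.map f id a = (w, k) := by
        rintro ⟨⟨a, b⟩, h⟩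
        exact hw ⟨a, congrArg Prod.fst h⟩
      simp [L, Function.extend_apply' _ _ _ this, edgeVec, h1, h2]
  unfold rankAt
  rw [(Submodule.equivMapOfInjective L hL _).finrank_eq, Submodule.map_span]
  suffices h : {x | ∃ u v, s(u, v) ∈ Sym2.map f '' F ∧ x = edgeVec p u v} =
      L '' {x | ∃ u v, s(u, v) ∈ F ∧ x = edgeVec (p ∘ f) u v} by rw [h]
  ext x
  constructor
  · rintro ⟨u, v, ⟨e, he, heq⟩, rfl⟩
    induction e with
    | _ a b =>
      rw [Sym2.map_mk, Sym2.eq_iff] at heq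
      refine ⟨_, ⟨a, b, he, rfl⟩, ?_⟩
      rcases heq with ⟨rfl, rfl⟩ | ⟨rfl, rfl⟩
      · exact key a b
      · rw [key, edgeVec_comm]
  · rintro ⟨_, ⟨a, b, he, rfl⟩, rfl⟩
    exact ⟨f a, f b, ⟨s(a, b), he, rfl⟩, key a b⟩

theorem rd_image_map {W : Type*} [DecidableEq W] (f : W ↪ V) (F : Set (Sym2 W)) :
    rd d (Sym2.map f '' F) = rd d F := by
  unfold rd
  congr 1
  ext n
  simp only [Set.mem_ofPred_eq, rankAt_image_map]
  constructor
  · rintro ⟨p, hp⟩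
    exact ⟨p ∘ f, hp⟩
  · rintro ⟨q, hq⟩
    refine ⟨Function.extend f q 0, ?_⟩
    rwa [show Function.extend f q 0 ∘ f = q from funext fun w => f.injective.extend_apply q 0 w]

section Finite

variable [Finite V]

theorem bddAbove_rankAt (F : Set (Sym2 V)) :
    BddAbove {n : ℕ | ∃ p : V → Fin d → ℝ, n = rankAt d p F} := by
  cases nonempty_fintype V
  refine ⟨Module.finrank ℝ (V × Fin d → ℝ), ?_⟩
  rintro _ ⟨p, rfl⟩
  exact Submodule.finrank_le _

theorem exists_linearIndependent_edgeVec (p : V → Fin d → ℝ) (F : Set (Sym2 V)) :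
    ∃ u v : Fin (rankAt d p F) → V, (∀ i, s(u i, v i) ∈ F) ∧
      LinearIndependent ℝ fun i => edgeVec p (u i) (v i) := by
  cases nonempty_fintype V
  obtain ⟨b, hbF, -, hb⟩ := Submodule.exists_fun_fin_finrank_span_eq ℝ
    {x : V × Fin d → ℝ | ∃ u v : V, s(u, v) ∈ F ∧ x = edgeVec p u v}
  choose u v huv hb' using hbF
  exact ⟨u, v, huv, (funext hb' : b = _) ▸ hb⟩

theorem zariskiGeneric_rankAt_eq_rd (F : Set (Sym2 V)) :
    ZariskiGeneric fun p : V → Fin d → ℝ => rankAt d p F = rd d F := by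
  cases nonempty_fintype V
  obtain ⟨p₀, hp₀⟩ : ∃ p : V → Fin d → ℝ, rd d F = rankAt d p F :=
    Nat.sSup_mem (s := {n : ℕ | ∃ p : V → Fin d → ℝ, n = rankAt d p F})
      ⟨rankAt d 0 F, 0, rfl⟩ (bddAbove_rankAt F)
  obtain ⟨u, v, huv, hind⟩ := exists_linearIndependent_edgeVec p₀ F
  let A : Matrix (Fin (rankAt d p₀ F)) (V × Fin d) (MvPolynomial (V × Fin d) ℝ) :=
    Matrix.of fun i wi => edgePoly (u i) (v i) wi
  have hA : ∀ p : V → Fin d → ℝ,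
      MvPolynomial.eval (fun vi => p vi.1 vi.2) (A * A.transpose).det ≠ 0 ↔
        LinearIndependent ℝ fun i => edgeVec p (u i) (v i) := by
    intro p
    have hmap : A.map (MvPolynomial.eval fun vi => p vi.1 vi.2) =
        Matrix.of fun i => edgeVec p (u i) (v i) := by
      ext i wi
      exact eval_edgePoly p _ _ _
    rw [RingHom.map_det, RingHom.mapMatrix_apply, Matrix.map_mul, Matrix.transpose_map, hmap,
      ← linearIndependent_row_iff_det_mul_transpose_ne_zero]
    rfl
  refine ⟨(A * A.transpose).det, fun h0 => ?_, fun p hp => ?_⟩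
  · have := (hA p₀).2 hind
    simp [h0] at this
  · refine le_antisymm (le_csSup (bddAbove_rankAt F) ⟨p, rfl⟩) ?_
    have hli := (hA p).1 hp
    rw [hp₀, ← Fintype.card_fin (rankAt d p₀ F), ← finrank_span_eq_card hli]
    refine Submodule.finrank_mono (Submodule.span_mono ?_)
    rintro _ ⟨i, rfl⟩
    exact ⟨u i, v i, huv i, rfl⟩

theorem edgeVec_mem_rowSpan_of_rankAt_insert {p : V → Fin d → ℝ} {F : Set (Sym2 V)} {u v : V}
    (h : rankAt d p (insert s(u, v) F) = rankAt d p F) : edgeVec p u v ∈ rowSpan p F := by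
  cases nonempty_fintype V
  have : rowSpan p F = rowSpan p (insert s(u, v) F) :=
    Submodule.eq_of_le_of_finrank_eq (rowSpan_mono p (Set.subset_insert _ _)) h.symm
  rw [this]
  exact edgeVec_mem_rowSpan p (Set.mem_insert _ _)

end Finite

theorem rankAt_insert_of_mem {p : V → Fin d → ℝ} {F : Set (Sym2 V)} {u v : V}
    (h : edgeVec p u v ∈ rowSpan p F) : rankAt d p (insert s(u, v) F) = rankAt d p F := by
  have : rowSpan p (insert s(u, v) F) = rowSpan p F := by
    refine le_antisymm (Submodule.span_le.2 ?_) (rowSpan_mono p (Set.subset_insert _ _))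
    rintro _ ⟨a, b, hab, rfl⟩
    rcases hab with hab | hab
    · rcases Sym2.eq_iff.1 hab with ⟨rfl, rfl⟩ | ⟨rfl, rfl⟩
      · exact h
      · rwa [SetLike.mem_coe, edgeVec_comm]
    · exact edgeVec_mem_rowSpan p hab
  exact congrArg (fun S : Submodule ℝ (V × Fin d → ℝ) => Module.finrank ℝ S) this

end RowSpan

/-- Twice the signed area of the triangle with vertices `p a`, `p b`, `p c`. -/
def area (p : V → Fin 2 → ℝ) (a b c : V) : ℝ :=
  (p b 0 - p a 0) * (p c 1 - p a 1) - (p c 0 - p a 0) * (p b 1 - p a 1)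

theorem zariskiGeneric_area_ne_zero {a b c : V} (hab : a ≠ b) (hac : a ≠ c) (hbc : b ≠ c) :
    ZariskiGeneric fun p : V → Fin 2 → ℝ => area p a b c ≠ 0 := by
  classical
  have h := zariskiGeneric_of_eval_ne_zero
    ((MvPolynomial.X (b, 0) - MvPolynomial.X (a, 0)) *
        (MvPolynomial.X (c, 1) - MvPolynomial.X (a, 1)) -
      (MvPolynomial.X (c, 0) - MvPolynomial.X (a, 0)) *
        (MvPolynomial.X (b, 1) - MvPolynomial.X (a, 1)))
    (fun v => ![if v = b then 1 else 0, if v = c then 1 else 0])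
    (by simp [hab, hac, hbc, hbc.symm])
  simpa [area] using h

section CompleteFour

variable [DecidableEq V]

/-- The equilibrium stress of a complete graph on four points of the plane. -/
theorem sum_area_smul_edgeVec_eq_zero (p : V → Fin 2 → ℝ) {y a b c : V}
    (hya : y ≠ a) (hyb : y ≠ b) (hyc : y ≠ c) (hab : a ≠ b) (hac : a ≠ c) (hbc : b ≠ c) :
    (area p a b c * area p y b c) • edgeVec p y a =
      (area p a b c * area p y a c) • edgeVec p y b -
      (area p a b c * area p y a b) • edgeVec p y c -
      (area p y b c * area p y a c) • edgeVec p a b +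
      (area p y b c * area p y a b) • edgeVec p a c -
      (area p y a c * area p y a b) • edgeVec p b c := by
  funext ⟨w, k⟩
  simp only [Pi.smul_apply, Pi.add_apply, Pi.sub_apply, smul_eq_mul, edgeVec]
  by_cases h1 : w = y
  · subst h1
    simp only [hya, hyb, hyc, if_true, if_false]
    fin_cases k <;> simp only [area, Fin.zero_eta, Fin.mk_one] <;> ring
  by_cases h2 : w = a
  · subst h2
    simp only [hya.symm, hab, hac, if_true, if_false]
    fin_cases k <;> simp only [area, Fin.zero_eta, Fin.mk_one] <;> ring
  by_cases h3 : w = b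
  · subst h3
    simp only [hyb.symm, hab.symm, hbc, if_true, if_false]
    fin_cases k <;> simp only [area, Fin.zero_eta, Fin.mk_one] <;> ring
  by_cases h4 : w = c
  · subst h4
    simp only [hyc.symm, hac.symm, hbc.symm, if_true, if_false]
    fin_cases k <;> simp only [area, Fin.zero_eta, Fin.mk_one] <;> ring
  simp [h1, h2, h3, h4]

theorem edgeVec_mem_of_area_ne_zero {p : V → Fin 2 → ℝ} {y a b c : V}
    (hya : y ≠ a) (hyb : y ≠ b) (hyc : y ≠ c) (hab : a ≠ b) (hac : a ≠ c) (hbc : b ≠ c)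
    (habc : area p a b c ≠ 0) (hybc : area p y b c ≠ 0)
    {S : Submodule ℝ (V × Fin 2 → ℝ)} (h₁ : edgeVec p y b ∈ S) (h₂ : edgeVec p y c ∈ S)
    (h₃ : edgeVec p a b ∈ S) (h₄ : edgeVec p a c ∈ S) (h₅ : edgeVec p b c ∈ S) :
    edgeVec p y a ∈ S := by
  rw [← S.smul_mem_iff (mul_ne_zero habc hybc),
    sum_area_smul_edgeVec_eq_zero p hya hyb hyc hab hac hbc]
  exact S.sub_mem (S.add_mem (S.sub_mem (S.sub_mem (S.smul_mem _ h₁) (S.smul_mem _ h₂))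
    (S.smul_mem _ h₃)) (S.smul_mem _ h₄)) (S.smul_mem _ h₅)

end CompleteFour

theorem edgeSet_addEdge (G : SimpleGraph V) {u v : V} (h : u ≠ v) :
    (addEdge G u v).edgeSet = insert s(u, v) G.edgeSet := by
  ext e
  induction e with
  | _ a b =>
    simp only [addEdge, SimpleGraph.mem_edgeSet, SimpleGraph.sup_adj,
      SimpleGraph.fromEdgeSet_adj, Set.mem_singleton_iff, Set.mem_insert_iff]
    constructor
    · tauto
    · rintro (hab | hab)
      · refine Or.inr ⟨hab, ?_⟩
        rcases Sym2.eq_iff.1 hab with ⟨rfl, rfl⟩ | ⟨rfl, rfl⟩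
        exacts [h, h.symm]
      · exact Or.inl hab

/-- At a generic placement, the row of a linked pair of an induced subgraph lies in the row
span of that subgraph. -/
theorem zariskiGeneric_edgeVec_mem_of_isLinked [Finite V] [DecidableEq V] {d : ℕ}
    (G : SimpleGraph V) (X : Set V) {a b : X} (hab : a ≠ b)
    (h : IsLinked d (G.induce X) a b) :
    ZariskiGeneric fun p : V → Fin d → ℝ =>
      edgeVec p (a : V) b ∈ rowSpan p (Sym2.map Subtype.val '' (G.induce X).edgeSet) := by
  let f : X ↪ V := Function.Embedding.subtype (· ∈ X)
  unfold IsLinked at h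
  rw [edgeSet_addEdge _ hab, ← rd_image_map f, ← rd_image_map f, Set.image_insert_eq] at h
  obtain ⟨g, hg, hgp⟩ := (zariskiGeneric_rankAt_eq_rd (d := d)
    (insert (Sym2.map f s(a, b)) (Sym2.map f '' (G.induce X).edgeSet))).and
    (zariskiGeneric_rankAt_eq_rd (Sym2.map f '' (G.induce X).edgeSet))
  refine ⟨g, hg, fun p hp => edgeVec_mem_rowSpan_of_rankAt_insert ?_⟩
  obtain ⟨h₁, h₂⟩ := hgp p hp
  exact h₁.trans (h.trans h₂.symm)

/-- If `G` is 2-rigid, `y` has degree 3 with `N_G(y) = {x₁,x₂,x₃}`, and all three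
edges at `y` are `ℛ₂`-bridges, then some pair `{x_i,x_j}` is not 2-linked in
`G−y`. -/
theorem neighbor_pair_not_linked {V : Type*} [Fintype V] [DecidableEq V]
    (G : SimpleGraph V) (hG : IsRigidGraph 2 G) (y x₁ x₂ x₃ : V)
    (h12 : x₁ ≠ x₂) (h13 : x₁ ≠ x₃) (h23 : x₂ ≠ x₃)
    (hN : G.neighborSet y = {x₁, x₂, x₃})
    (hb : ∀ i ∈ ({x₁, x₂, x₃} : Set V), IsRdBridge 2 G s(y, i)) :
    ∃ a b : ({y}ᶜ : Set V), (a : V) ∈ ({x₁, x₂, x₃} : Set V) ∧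
      (b : V) ∈ ({x₁, x₂, x₃} : Set V) ∧ a ≠ b ∧
      ¬ IsLinked 2 (G.induce ({y}ᶜ : Set V)) a b := by
  have hadj : ∀ i ∈ ({x₁, x₂, x₃} : Set V), G.Adj y i := fun i hi => by
    rwa [← hN] at hi
  have ha₁ := hadj x₁ (by simp)
  have ha₂ := hadj x₂ (by simp)
  have ha₃ := hadj x₃ (by simp)
  by_contra! hlinked
  have hgen : ∀ a b : V, a ∈ ({x₁, x₂, x₃} : Set V) → b ∈ ({x₁, x₂, x₃} : Set V) → a ≠ b →
      ZariskiGeneric fun p : V → Fin 2 → ℝ => edgeVec p a b ∈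
        rowSpan p (Sym2.map Subtype.val '' (G.induce ({y}ᶜ : Set V)).edgeSet) :=
    fun a b ha hb hab => zariskiGeneric_edgeVec_mem_of_isLinked G ({y}ᶜ)
      (a := ⟨a, (hadj a ha).ne'⟩) (b := ⟨b, (hadj b hb).ne'⟩) (by simpa [Subtype.ext_iff] using hab)
      (hlinked _ _ ha hb (by simpa [Subtype.ext_iff] using hab))
  obtain ⟨p, ⟨⟨h₁₂, h₁₃⟩, h₂₃⟩, ⟨hE, hE'⟩, hA, hA'⟩ :=
    ((((hgen x₁ x₂ (by simp) (by simp) h12).and (hgen x₁ x₃ (by simp) (by simp) h13)).and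
      (hgen x₂ x₃ (by simp) (by simp) h23)).and
      (((zariskiGeneric_rankAt_eq_rd G.edgeSet).and
        (zariskiGeneric_rankAt_eq_rd (G.edgeSet \ {s(y, x₁)}))).and
      ((zariskiGeneric_area_ne_zero h12 h13 h23).and
        (zariskiGeneric_area_ne_zero ha₂.ne ha₃.ne h23)))).exists_placement
  have hsub : Sym2.map Subtype.val '' (G.induce ({y}ᶜ : Set V)).edgeSet ⊆
      G.edgeSet \ {s(y, x₁)} := by
    rintro _ ⟨e, he, rfl⟩
    induction e with
    | _ a b =>
      refine ⟨by simpa using he, fun h => ?_⟩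
      rcases Sym2.eq_iff.1 (h : s((a : V), (b : V)) = s(y, x₁)) with ⟨h, -⟩ | ⟨-, h⟩
      exacts [a.2 h, b.2 h]
  have hmono := rowSpan_mono p hsub
  have hmem : edgeVec p y x₁ ∈ rowSpan p (G.edgeSet \ {s(y, x₁)}) :=
    edgeVec_mem_of_area_ne_zero ha₁.ne ha₂.ne ha₃.ne h12 h13 h23 hA hA'
      (edgeVec_mem_rowSpan p ⟨ha₂, by simp [h12.symm, ha₁.ne]⟩)
      (edgeVec_mem_rowSpan p ⟨ha₃, by simp [h13.symm, ha₁.ne]⟩)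
      (hmono h₁₂) (hmono h₁₃) (hmono h₂₃)
  have hrank := rankAt_insert_of_mem hmem
  obtain ⟨hmemE, hbridge⟩ := hb x₁ (by simp)
  rw [Set.insert_sdiff_singleton, Set.insert_eq_of_mem hmemE, hE, hE'] at hrank
  omega

end Rigidity
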